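/- Let a_M ∈ L¹(Ω̃), φ ∈ C(Ω̄×Ȳ) Y-periodic in y, and a(x,y) the two-scale discrete extension of a_M. Then ∫_Ω a(x,x/ε)φ(x,x/ε)dx → ∫_Ω∫_Y a(x,y)φ(x,y)dydx as ε→0 (assuming each ∂Ω_j is regular enough that the measure of boundary ε-cube layers tends to 0). -/

import Mathlib

open MeasureTheory Filter Topology Function Matrix

noncomputable section

/-- The unit cube `Y = (0,1)^d`. -/
def unitCube (d : ℕ) : Set (Fin d → ℝ) := Set.univ.pi fun _ => Set.Ioo (0:ℝ) 1

/-- The axis-aligned closed cube of side `r` centered at `c`. -/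
def cube {d : ℕ} (c : Fin d → ℝ) (r : ℝ) : Set (Fin d → ℝ) := {z | ∀ k, |z k - c k| ≤ r / 2}

/-- `f(x, ·)` is `Y`-periodic (period `1` in each coordinate direction). -/
def YPeriodic {d : ℕ} (f : (Fin d → ℝ) → (Fin d → ℝ) → ℝ) : Prop :=
  ∀ (x y : Fin d → ℝ) (m : Fin d → ℤ), f x (y + fun i => (m i : ℝ)) = f x y

/-- Test functions `ψ ∈ D(Ω × Y)`: `Y`-periodic in `y`, and on `Ω × Y` given by a smooth
compactly supported function with support inside `Ω × Y`. -/
def IsTestFunction {d : ℕ} (Ω : Set (Fin d → ℝ)) (ψ : (Fin d → ℝ) → (Fin d → ℝ) → ℝ) : Prop :=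
  YPeriodic ψ ∧ ∃ ψ₀ : (Fin d → ℝ) × (Fin d → ℝ) → ℝ,
    ContDiff ℝ (⊤ : ℕ∞) ψ₀ ∧ HasCompactSupport ψ₀ ∧
    tsupport ψ₀ ⊆ Ω ×ˢ unitCube d ∧
    ∀ x y, y ∈ unitCube d → ψ x y = ψ₀ (x, y)

/-- Two-scale convergence of `u_ε` (indexed along a sequence `ε n → 0`) to `u₀ ∈ L²(Ω×Y)`:
boundedness in `L²(Ω)` together with convergence against every test function in `D(Ω×Y)`. -/
def TwoScale {d : ℕ} (Ω : Set (Fin d → ℝ)) (ε : ℕ → ℝ)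
    (u : ℕ → (Fin d → ℝ) → ℝ) (u₀ : (Fin d → ℝ) → (Fin d → ℝ) → ℝ) : Prop :=
  (∃ C : ℝ, ∀ n, ∫ x in Ω, (u n x) ^ 2 ≤ C) ∧
  ∀ ψ, IsTestFunction Ω ψ →
    Tendsto (fun n => ∫ x in Ω, u n x * ψ x ((ε n)⁻¹ • x)) atTop
      (𝓝 (∫ x in Ω, ∫ y in unitCube d, u₀ x y * ψ x y))

/-- `φ` is an admissible test function: one may pass to the two-scale limit against it. -/
def Admissible {d : ℕ} (Ω : Set (Fin d → ℝ)) (ε : ℕ → ℝ)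
    (φ : (Fin d → ℝ) → (Fin d → ℝ) → ℝ) : Prop :=
  ∀ u u₀, TwoScale Ω ε u u₀ →
    Tendsto (fun n => ∫ x in Ω, u n x * φ x ((ε n)⁻¹ • x)) atTop
      (𝓝 (∫ x in Ω, ∫ y in unitCube d, u₀ x y * φ x y))

/-- The two-scale Continuous Extension of `a_M` with parameter `ε̄ = eb`:
`a(x,y) = ã(x, ε̄ y)` where `ã(x,·) = a_M` on the `ε̄`-cube `W(x)` centered at `x`,
extended `ε̄`-periodically. -/
def contExt {d : ℕ} (aM : (Fin d → ℝ) → ℝ) (eb : ℝ) (x y : Fin d → ℝ) : ℝ :=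
  aM fun k => x k + eb * (Int.fract (y k - x k / eb + 1/2) - 1/2)

/-- The two-scale Discrete Extension of `a_M` associated to a partition `Ω = ⋃ j, Ωp j`
with `ε̄`-cubes `W_j` centered at `xh j`. -/
def discExt {d : ℕ} (aM : (Fin d → ℝ) → ℝ) (eb : ℝ) {N : ℕ} (Ωp : Fin N → Set (Fin d → ℝ))
    (xh : Fin N → (Fin d → ℝ)) (x y : Fin d → ℝ) : ℝ :=
  ∑ j, (Ωp j).indicator (fun _ => contExt aM eb (xh j) y) x

/-- `ε̄`-periodicity of a function on `ℝ^d`. -/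
def perZ {d : ℕ} (eb : ℝ) (f : (Fin d → ℝ) → ℝ) : Prop :=
  ∀ (z : Fin d → ℝ) (m : Fin d → ℤ), f (z + eb • fun i => (m i : ℝ)) = f z

/-- `g` is the weak gradient of `f`. -/
def IsWeakGrad {d : ℕ} (f : (Fin d → ℝ) → ℝ) (g : (Fin d → ℝ) → (Fin d → ℝ)) : Prop :=
  LocallyIntegrable f volume ∧ (∀ k, LocallyIntegrable (fun z => g z k) volume) ∧
  ∀ ψ : (Fin d → ℝ) → ℝ, ContDiff ℝ (⊤ : ℕ∞) ψ → HasCompactSupport ψ → ∀ k : Fin d,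
    ∫ z, f z * fderiv ℝ ψ z (Pi.single k 1) = - ∫ z, g z k * ψ z


/-- The coordinatewise fractional part. -/
def fractVec {d : ℕ} (y : Fin d → ℝ) : Fin d → ℝ := fun k => Int.fract (y k)

/-- Lebesgue measure on the half-open unit cube `[0,1)^d`. -/
def cubeMeasure (d : ℕ) : Measure (Fin d → ℝ) :=
  volume.restrict (Set.univ.pi fun _ => Set.Ico (0:ℝ) 1)

lemma measurable_fractVec {d : ℕ} : Measurable (fractVec (d := d)) :=
  measurable_pi_lambda _ fun k => (measurable_pi_apply k).fract

lemma fractVec_mem {d : ℕ} (y : Fin d → ℝ) :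
    fractVec y ∈ Set.univ.pi fun _ => Set.Ico (0:ℝ) 1 :=
  fun _ _ => ⟨Int.fract_nonneg _, Int.fract_lt_one _⟩

lemma fractVec_eq_self {d : ℕ} {y : Fin d → ℝ}
    (hy : y ∈ Set.univ.pi fun _ => Set.Ico (0:ℝ) 1) : fractVec y = y :=
  funext fun k => Int.fract_eq_self.2 (hy k trivial)

lemma fractVec_fractVec {d : ℕ} (y : Fin d → ℝ) : fractVec (fractVec y) = fractVec y :=
  fractVec_eq_self (fractVec_mem y)

lemma fractVec_fractVec_add {d : ℕ} (y s : Fin d → ℝ) :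
    fractVec (fractVec y + s) = fractVec (y + s) := by
  funext k
  refine Int.fract_eq_fract.2 ⟨-⌊y k⌋, ?_⟩
  simp only [fractVec, Pi.add_apply, Int.fract]
  push_cast
  ring

lemma norm_fractVec_le_one {d : ℕ} (y : Fin d → ℝ) : ‖fractVec y‖ ≤ 1 := by
  refine (pi_norm_le_iff_of_nonneg zero_le_one).2 fun k => ?_
  rw [fractVec, Real.norm_of_nonneg (Int.fract_nonneg _)]
  exact (Int.fract_lt_one _).le

lemma measurableSet_unitIco (d : ℕ) :
    MeasurableSet (Set.univ.pi fun _ : Fin d => Set.Ico (0:ℝ) 1) :=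
  MeasurableSet.univ_pi fun _ => measurableSet_Ico

lemma cubeMeasure_eq_pi (d : ℕ) :
    cubeMeasure d = Measure.pi fun _ => volume.restrict (Set.Ico (0:ℝ) 1) := by
  rw [cubeMeasure, volume_pi, Measure.restrict_pi_pi]

instance (d : ℕ) : IsProbabilityMeasure (cubeMeasure d) := by
  have : IsProbabilityMeasure (volume.restrict (Set.Ico (0:ℝ) 1)) := ⟨by simp⟩
  rw [cubeMeasure_eq_pi]
  infer_instance

lemma cubeMeasure_eq_restrict_unitCube (d : ℕ) :
    cubeMeasure d = volume.restrict (unitCube d) := by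
  refine Measure.restrict_congr_set ?_
  exact (Measure.univ_pi_Ico_ae_eq_Icc (μ := fun _ : Fin d => (volume : Measure ℝ))
    (f := fun _ => (0:ℝ)) (g := fun _ => 1)).trans
    (Measure.univ_pi_Ioo_ae_eq_Icc (μ := fun _ : Fin d => (volume : Measure ℝ))
      (f := fun _ => (0:ℝ)) (g := fun _ => 1)).symm

/-- Translation modulo one preserves Lebesgue measure on `[0,1)`. -/
lemma measurePreserving_fract_add (s : ℝ) :
    MeasurePreserving (fun t : ℝ => Int.fract (t + s)) (volume.restrict (Set.Ico (0:ℝ) 1))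
      (volume.restrict (Set.Ico (0:ℝ) 1)) := by
  have hmk : MeasurePreserving ((↑) : ℝ → UnitAddCircle) (volume.restrict (Set.Ico (0:ℝ) 1))
      volume := by
    rw [Measure.restrict_congr_set Ico_ae_eq_Ioc]
    simpa using UnitAddCircle.measurePreserving_mk 0
  let r : UnitAddCircle → ℝ := fun c => (AddCircle.equivIco 1 0 c : ℝ)
  have hr : ∀ t : ℝ, r t = Int.fract t := fun t => by
    simp [r, AddCircle.coe_equivIco_mk_apply]
  have hrm : Measurable r :=
    measurable_subtype_coe.comp (AddCircle.measurableEquivIco 1 0).measurable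
  have hrp : MeasurePreserving r volume (volume.restrict (Set.Ico (0:ℝ) 1)) := by
    refine ⟨hrm, ?_⟩
    rw [← hmk.map_eq, Measure.map_map hrm hmk.measurable]
    conv_rhs => rw [← Measure.map_id (μ := volume.restrict (Set.Ico (0:ℝ) 1))]
    refine Measure.map_congr ?_
    filter_upwards [ae_restrict_mem measurableSet_Ico] with t ht
    simp [hr, Int.fract_eq_self.2 ht]
  have := hrp.comp ((measurePreserving_add_right volume (s : UnitAddCircle)).comp hmk)
  convert this using 1
  funext t
  exact (hr (t + s)).symm

lemma measurePreserving_fractVec_add {d : ℕ} (s : Fin d → ℝ) :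
    MeasurePreserving (fun y => fractVec (y + s)) (cubeMeasure d) (cubeMeasure d) := by
  rw [cubeMeasure_eq_pi]
  exact measurePreserving_pi _ _ fun k => measurePreserving_fract_add (s k)

lemma integral_comp_fractVec_add {d : ℕ} (s : Fin d → ℝ) {h : (Fin d → ℝ) → ℝ}
    (hh : AEStronglyMeasurable h (cubeMeasure d)) :
    ∫ t, h (fractVec (t + s)) ∂cubeMeasure d = ∫ t, h t ∂cubeMeasure d := by
  have hT := measurePreserving_fractVec_add s
  conv_rhs => rw [← hT.map_eq]
  rw [← hT.map_eq] at hh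
  exact (integral_map hT.measurable.aemeasurable hh).symm

lemma quasiMeasurePreserving_fractVec (d : ℕ) :
    Measure.QuasiMeasurePreserving (fractVec (d := d)) volume (cubeMeasure d) := by
  refine ⟨measurable_fractVec, Measure.AbsolutelyContinuous.mk fun N hN h0 => ?_⟩
  rw [Measure.map_apply measurable_fractVec hN]
  rw [cubeMeasure, Measure.restrict_apply hN] at h0
  refine measure_mono_null (t := ⋃ m : Fin d → ℤ, (fun y : Fin d → ℝ => y + fun k => -(m k : ℝ)) ⁻¹'
    (N ∩ Set.univ.pi fun _ => Set.Ico (0:ℝ) 1)) (fun y hy => ?_) ?_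
  · have : (y + fun k => -((⌊y k⌋ : ℤ) : ℝ)) = fractVec y := by
      funext k
      simp [fractVec, Int.fract, sub_eq_add_neg]
    refine Set.mem_iUnion.2 ⟨fun k => ⌊y k⌋, ?_⟩
    rw [Set.mem_preimage, this]
    exact ⟨hy, fractVec_mem y⟩
  · exact measure_iUnion_null fun m => by rw [measure_preimage_add_right, h0]

lemma YPeriodic.apply_fractVec {d : ℕ} {f : (Fin d → ℝ) → (Fin d → ℝ) → ℝ} (hf : YPeriodic f)
    (x y : Fin d → ℝ) : f x (fractVec y) = f x y := by
  rw [← hf x (fractVec y) fun k => ⌊y k⌋]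
  congr 1
  funext k
  exact Int.fract_add_floor (y k)

/-- Mean-value property of periodically oscillating functions: if `f` is `1`-periodic in the second
variable, dominated by an integrable function and continuous in the first variable at almost every
point, then `∫ f(x, x/ε) dx` tends to the average `∬ f(x, y) dy dx`. -/
lemma tendsto_integral_oscillating {d : ℕ} (f : (Fin d → ℝ) → (Fin d → ℝ) → ℝ)
    (hfm : Measurable (uncurry f)) (hfp : ∀ x y, f x (fractVec y) = f x y)
    (β : (Fin d → ℝ) → ℝ) (hβ : Integrable β (cubeMeasure d))
    (hfβ : ∀ x y, ‖f x y‖ ≤ β (fractVec y)) (R : ℝ) (hfR : ∀ x y, R < ‖x‖ → f x y = 0)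
    (hfc : ∀ᵐ x, ∀ y, ContinuousAt (fun z => f z y) x) :
    Tendsto (fun ε : ℝ => ∫ x, f x (ε⁻¹ • x)) (𝓝[>] (0:ℝ))
      (𝓝 (∫ x, ∫ y, f x y ∂cubeMeasure d)) := by
  let B : Set (Fin d → ℝ) := Metric.closedBall 0 (R + 1)
  have hBm : MeasurableSet B := Metric.isClosed_closedBall.measurableSet
  have hBfin : volume B ≠ ⊤ := (isCompact_closedBall _ _).measure_lt_top.ne
  have hB1 : Integrable (B.indicator fun _ => (1:ℝ)) volume :=
    (integrable_indicator_iff hBm).2 (integrableOn_const hBfin)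
  have hsmall : ∀ ε : ℝ, 0 < ε → ε ≤ 1 → ∀ x t : Fin d → ℝ, ‖t‖ ≤ 1 → ∀ y,
      ‖f (x + ε • t) y‖ ≤ B.indicator (fun _ => (1:ℝ)) x * β (fractVec y) := by
    intro ε hε hε1 x t ht y
    by_cases hx : x ∈ B
    · simpa [hx] using hfβ (x + ε • t) y
    · have hx' : R + 1 < ‖x‖ := by simpa [B] using hx
      have h1 : ‖ε • t‖ ≤ 1 := by
        rw [norm_smul, Real.norm_of_nonneg hε.le]
        nlinarith [norm_nonneg t]
      have h2 := norm_sub_le (x + ε • t) (ε • t)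
      rw [add_sub_cancel_right] at h2
      rw [hfR _ _ (by linarith)]
      simp [hx]
  have hβT : ∀ s, Integrable (fun t => β (fractVec (t + s))) (cubeMeasure d) := fun s =>
    (measurePreserving_fractVec_add s).integrable_comp_of_integrable hβ
  have hcube : ∀ᵐ t ∂cubeMeasure d, t ∈ Set.univ.pi fun _ => Set.Ico (0:ℝ) 1 :=
    ae_restrict_mem (measurableSet_unitIco d)
  have hbound : Integrable (fun p : (Fin d → ℝ) × (Fin d → ℝ) =>
      B.indicator (fun _ => (1:ℝ)) p.1 * β (fractVec p.2)) (volume.prod (cubeMeasure d)) :=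
    hB1.mul_prod (by simpa using hβT 0)
  have hshift : ∀ ε : ℝ, Measurable fun p : (Fin d → ℝ) × (Fin d → ℝ) =>
      f (p.1 + ε • fractVec (p.2 - ε⁻¹ • p.1)) p.2 := fun ε =>
    hfm.comp (f := fun p : (Fin d → ℝ) × (Fin d → ℝ) =>
      (p.1 + ε • fractVec (p.2 - ε⁻¹ • p.1), p.2))
      (have := measurable_fractVec (d := d); by fun_prop)
  have key : ∀ ε : ℝ, 0 < ε → ε ≤ 1 → ∫ x, f x (ε⁻¹ • x) =
      ∫ p, f (p.1 + ε • fractVec (p.2 - ε⁻¹ • p.1)) p.2 ∂(volume.prod (cubeMeasure d)) := by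
    intro ε hε hε1
    have hGm : Measurable fun p : (Fin d → ℝ) × (Fin d → ℝ) =>
        f (p.1 + ε • p.2) (p.2 + ε⁻¹ • p.1) :=
      hfm.comp (f := fun p : (Fin d → ℝ) × (Fin d → ℝ) => (p.1 + ε • p.2, p.2 + ε⁻¹ • p.1))
        (by fun_prop)
    have hGb : ∀ x, ∀ᵐ t ∂cubeMeasure d, ‖f (x + ε • t) (t + ε⁻¹ • x)‖ ≤
        B.indicator (fun _ => (1:ℝ)) x * β (fractVec (t + ε⁻¹ • x)) := fun x => by
      filter_upwards [hcube] with t ht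
      refine hsmall ε hε hε1 x t ?_ _
      rw [← fractVec_eq_self ht]
      exact norm_fractVec_le_one t
    have hGi : Integrable (fun p : (Fin d → ℝ) × (Fin d → ℝ) =>
        f (p.1 + ε • p.2) (p.2 + ε⁻¹ • p.1)) (volume.prod (cubeMeasure d)) := by
      refine (integrable_prod_iff hGm.aestronglyMeasurable).2 ⟨ae_of_all _ fun x => ?_, ?_⟩
      · exact ((hβT _).const_mul _).mono' (hGm.comp measurable_prodMk_left).aestronglyMeasurable
          (hGb x)
      · refine (hB1.mul_const (∫ t, β t ∂cubeMeasure d)).mono'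
          hGm.norm.stronglyMeasurable.integral_prod_right'.aestronglyMeasurable
          (ae_of_all _ fun x => ?_)
        rw [Real.norm_of_nonneg (integral_nonneg fun _ => norm_nonneg _)]
        refine (integral_mono_of_nonneg (ae_of_all _ fun _ => norm_nonneg _)
          ((hβT (ε⁻¹ • x)).const_mul _) (hGb x)).trans_eq ?_
        rw [integral_const_mul]
        congr 1
        exact integral_comp_fractVec_add _ hβ.aestronglyMeasurable
    have hHm : Measurable fun p : (Fin d → ℝ) × (Fin d → ℝ) =>
        f (p.1 + ε • fractVec (p.2 - ε⁻¹ • p.1)) p.2 := hshift ε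
    have hHi := (hbound.mono' hHm.aestronglyMeasurable (ae_of_all _ fun p =>
      hsmall ε hε hε1 p.1 _ (norm_fractVec_le_one _) p.2))
    have htrans : ∀ t : Fin d → ℝ,
        ∫ x, f (x + ε • t) (t + ε⁻¹ • x) = ∫ x, f x (ε⁻¹ • x) := fun t => by
      rw [← integral_add_right_eq_self (fun x => f x (ε⁻¹ • x)) (ε • t)]
      refine integral_congr_ae (ae_of_all _ fun x => ?_)
      simp only [smul_add, inv_smul_smul₀ hε.ne', add_comm]
    calc ∫ x, f x (ε⁻¹ • x)
        = ∫ t, (∫ x, f (x + ε • t) (t + ε⁻¹ • x)) ∂cubeMeasure d := by simp [htrans]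
      _ = ∫ x, ∫ t, f (x + ε • t) (t + ε⁻¹ • x) ∂cubeMeasure d :=
        (integral_integral_swap (f := fun x t => f (x + ε • t) (t + ε⁻¹ • x)) hGi).symm
      _ = ∫ x, ∫ t, f (x + ε • fractVec (t - ε⁻¹ • x)) t ∂cubeMeasure d := by
        refine integral_congr_ae (ae_of_all _ fun x => ?_)
        simp only
        rw [← integral_comp_fractVec_add (ε⁻¹ • x)
          (h := fun t => f (x + ε • fractVec (t - ε⁻¹ • x)) t)
          (hHm.comp measurable_prodMk_left).aestronglyMeasurable]
        refine integral_congr_ae (hcube.mono fun t ht => ?_)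
        simp only
        rw [hfp, sub_eq_add_neg, fractVec_fractVec_add, add_neg_cancel_right, fractVec_eq_self ht]
      _ = _ := (integral_prod _ hHi).symm
  have hlim : ∫ x, ∫ y, f x y ∂cubeMeasure d =
      ∫ p, f p.1 p.2 ∂(volume.prod (cubeMeasure d)) :=
    (integral_prod _ (hbound.mono' hfm.aestronglyMeasurable (ae_of_all _ fun p => by
      simpa [uncurry] using hsmall 1 one_pos le_rfl p.1 0 (by simp) p.2))).symm
  have hev : ∀ᶠ ε : ℝ in 𝓝[>] 0, 0 < ε ∧ ε ≤ 1 := by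
    filter_upwards [Ioc_mem_nhdsGT (zero_lt_one (α := ℝ))] with ε hε using hε
  rw [hlim]
  refine Tendsto.congr' (hev.mono fun ε hε => (key ε hε.1 hε.2).symm) ?_
  refine tendsto_integral_filter_of_dominated_convergence _
    (Eventually.of_forall fun ε => (hshift ε).aestronglyMeasurable)
    (hev.mono fun ε hε => ae_of_all _ fun p =>
      hsmall ε hε.1 hε.2 p.1 _ (norm_fractVec_le_one _) p.2) hbound ?_
  filter_upwards [Measure.quasiMeasurePreserving_fst.ae hfc] with p hp
  refine (hp p.2).tendsto.comp ?_
  have h0 : Tendsto (fun ε : ℝ => ε • fractVec (p.2 - ε⁻¹ • p.1)) (𝓝[>] 0) (𝓝 0) := by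
    refine squeeze_zero_norm (a := fun ε => ‖ε‖) (fun ε => ?_)
      (tendsto_norm_zero.mono_left nhdsWithin_le_nhds)
    rw [norm_smul]
    exact mul_le_of_le_one_right (norm_nonneg _) (norm_fractVec_le_one _)
  simpa using h0.const_add p.1

lemma contExt_eq_comp_fractVec {d : ℕ} (aM : (Fin d → ℝ) → ℝ) (eb : ℝ) (c y : Fin d → ℝ) :
    contExt aM eb c y =
      (fun z => aM (eb • z + fun k => c k - eb / 2)) (fractVec (y + fun k => 1 / 2 - c k / eb)) := by
  simp only [contExt]
  congr 1
  funext k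
  simp only [fractVec, Pi.add_apply, Pi.smul_apply, smul_eq_mul,
    show y k - c k / eb + 1 / 2 = y k + (1 / 2 - c k / eb) by ring]
  ring

lemma contExt_fractVec {d : ℕ} (aM : (Fin d → ℝ) → ℝ) (eb : ℝ) (c y : Fin d → ℝ) :
    contExt aM eb c (fractVec y) = contExt aM eb c y := by
  rw [contExt_eq_comp_fractVec, contExt_eq_comp_fractVec, fractVec_fractVec_add]

lemma integrable_contExt {d : ℕ} {aM : (Fin d → ℝ) → ℝ} {eb : ℝ} {c : Fin d → ℝ} (heb : 0 < eb)
    (ha : IntegrableOn aM (cube c eb)) : Integrable (contExt aM eb c) (cubeMeasure d) := by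
  have hcube : MeasurableSet (cube c eb) := by
    simp only [cube, Set.ofPred_forall]
    exact MeasurableSet.iInter fun k => measurableSet_le (by fun_prop) measurable_const
  have hG : Integrable (fun z : Fin d → ℝ =>
      (cube c eb).indicator aM (eb • z + fun k => c k - eb / 2)) volume :=
    (((integrable_indicator_iff hcube).2 ha).comp_add_right _).comp_smul heb.ne'
  have hh : Integrable (fun z => aM (eb • z + fun k => c k - eb / 2)) (cubeMeasure d) := by
    refine (hG.mono_measure Measure.restrict_le_self).congr ?_
    filter_upwards [ae_restrict_mem (measurableSet_unitIco d)] with z hz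
    refine Set.indicator_of_mem (fun k => ?_) aM
    have hk := hz k trivial
    simp only [Pi.add_apply, Pi.smul_apply, smul_eq_mul, abs_le]
    constructor <;> nlinarith [hk.1, hk.2]
  rw [funext (contExt_eq_comp_fractVec aM eb c)]
  exact (measurePreserving_fractVec_add _).integrable_comp_of_integrable hh

/-- Away from the frontier of `s`, the product of the indicator of `s` with a function that is
continuous in the interior of `s` is continuous. -/
lemma continuousAt_indicator_mul {X : Type*} [TopologicalSpace X] {s : Set X} {x : X}
    (hx : x ∉ frontier s) {g : X → ℝ} (hg : x ∈ interior s → ContinuousAt g x) :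
    ContinuousAt (fun z => s.indicator (fun _ => (1:ℝ)) z * g z) x := by
  by_cases hxi : x ∈ interior s
  · refine (hg hxi).congr ?_
    filter_upwards [mem_interior_iff_mem_nhds.1 hxi] with z hz
    simp [hz]
  · have hxc : x ∉ closure s := fun h => hx ⟨h, hxi⟩
    refine (continuousAt_const (y := (0:ℝ))).congr ?_
    filter_upwards [isClosed_closure.isOpen_compl.mem_nhds hxc] with z hz
    rw [Set.indicator_of_notMem fun h => hz (subset_closure h), zero_mul]

/-- For `a_M ∈ L¹(Ω̃)`, `φ` continuous on the closure of `Ω × Y` and `Y`-periodic in `y`,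
and `a` the two-scale Discrete Extension:
`∫_Ω a(x,x/ε)φ(x,x/ε) dx → ∫_Ω ∫_Y a(x,y)φ(x,y) dy dx` as `ε → 0⁺` (each boundary `∂Ω_j`
being regular enough: a Lebesgue null set). -/
theorem statement16 {d : ℕ} (Ωt Ω : Set (Fin d → ℝ))
    (hΩo : IsOpen Ω) (hΩb : Bornology.IsBounded Ω) (hΩt : Bornology.IsBounded Ωt)
    (N : ℕ) (Ωp : Fin N → Set (Fin d → ℝ)) (xh : Fin N → (Fin d → ℝ))
    (hmeas : ∀ j, MeasurableSet (Ωp j))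
    (hdisj : Pairwise (Function.onFun Disjoint Ωp))
    (hpart : closure Ω = ⋃ j, closure (Ωp j))
    (hsub : ∀ j, Ωp j ⊆ Ω)
    (hfr : ∀ j, volume (frontier (Ωp j)) = 0)
    (eb : ℝ) (heb : 0 < eb)
    (hcube : ∀ j, Ωp j ⊆ cube (xh j) eb)
    (hWsub : ∀ j, cube (xh j) eb ⊆ Ωt)
    (aM : (Fin d → ℝ) → ℝ) (haM : IntegrableOn aM Ωt)
    (φ : (Fin d → ℝ) → (Fin d → ℝ) → ℝ) (hper : YPeriodic φ)
    (hcont : ContinuousOn (uncurry φ) (closure Ω ×ˢ closure (unitCube d))) :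
    Tendsto (fun ε : ℝ => ∫ x in Ω, discExt aM eb Ωp xh x (ε⁻¹ • x) * φ x (ε⁻¹ • x))
      (𝓝[>] (0:ℝ))
      (𝓝 (∫ x in Ω, ∫ y in unitCube d, discExt aM eb Ωp xh x y * φ x y)) := by
  classical
  set K := closure Ω
  have hK : IsCompact K := hΩb.isCompact_closure
  let Q : Set (Fin d → ℝ) := closure (unitCube d)
  have hQ : Q = Set.univ.pi fun _ => Set.Icc (0:ℝ) 1 := by
    simp only [Q, unitCube, closure_pi_set, closure_Ioo zero_ne_one]
  have hQc : IsCompact Q := by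
    rw [hQ]
    exact isCompact_univ_pi fun _ => isCompact_Icc
  have hfQ : ∀ y : Fin d → ℝ, fractVec y ∈ Q := fun y => by
    rw [hQ]
    exact fun k _ => ⟨Int.fract_nonneg _, (Int.fract_lt_one _).le⟩
  obtain ⟨C, hC⟩ := (hK.prod hQc).exists_bound_of_continuousOn hcont
  obtain ⟨R, hR⟩ := hΩb.exists_norm_le
  -- Measurable representatives of `φ` and of the periodic extensions of `aM`.
  let Φ : (Fin d → ℝ) × (Fin d → ℝ) → ℝ := fun p =>
    (K ×ˢ Q).piecewise (uncurry φ) (fun _ => 0) (p.1, fractVec p.2)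
  have hΦ : ∀ x ∈ K, ∀ y, Φ (x, y) = φ x y := fun x hx y => by
    rw [← hper.apply_fractVec x y]
    exact Set.piecewise_eq_of_mem _ _ _ ⟨hx, hfQ y⟩
  have hΦp : ∀ x y, Φ (x, fractVec y) = Φ (x, y) := fun x y =>
    congrArg (fun z => (K ×ˢ Q).piecewise (uncurry φ) (fun _ => 0) (x, z)) (fractVec_fractVec y)
  have hΦm : Measurable Φ :=
    (ContinuousOn.measurable_piecewise hcont continuousOn_const
      (hK.isClosed.prod hQc.isClosed).measurableSet).comp
      (measurable_fst.prodMk (measurable_fractVec.comp measurable_snd))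
  have hb : ∀ j, Integrable (contExt aM eb (xh j)) (cubeMeasure d) := fun j =>
    integrable_contExt heb (haM.mono_set (hWsub j))
  let b : Fin N → (Fin d → ℝ) → ℝ := fun j => (hb j).aestronglyMeasurable.mk
  have hbm : ∀ j, Measurable (b j) := fun j =>
    (hb j).aestronglyMeasurable.stronglyMeasurable_mk.measurable
  have hbeq : ∀ j, contExt aM eb (xh j) =ᵐ[cubeMeasure d] b j := fun j =>
    (hb j).aestronglyMeasurable.ae_eq_mk
  have hbae : ∀ᵐ y ∂cubeMeasure d, ∀ j, contExt aM eb (xh j) y = b j y := ae_all_iff.2 hbeq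
  have hbae' : ∀ᵐ y : Fin d → ℝ, ∀ j, contExt aM eb (xh j) y = b j (fractVec y) := by
    filter_upwards [(quasiMeasurePreserving_fractVec d).ae hbae] with y hy j
    rw [← hy j, contExt_fractVec]
  let f : (Fin d → ℝ) → (Fin d → ℝ) → ℝ := fun x y =>
    ∑ j, (Ωp j).indicator (fun _ => (1:ℝ)) x * (b j (fractVec y) * Φ (x, y))
  have hf0 : ∀ x ∉ Ω, ∀ y, f x y = 0 := fun x hx y =>
    Finset.sum_eq_zero fun j _ => by
      rw [Set.indicator_of_notMem fun h => hx (hsub j h), zero_mul]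
  have hfeq : ∀ x y, (∀ j, contExt aM eb (xh j) y = b j (fractVec y)) →
      Ω.indicator (fun x => discExt aM eb Ωp xh x y * φ x y) x = f x y := by
    intro x y hy
    by_cases hx : x ∈ Ω
    · rw [Set.indicator_of_mem hx, discExt, Finset.sum_mul]
      refine Finset.sum_congr rfl fun j _ => ?_
      rw [hΦ x (subset_closure hx), ← hy j]
      by_cases hxj : x ∈ Ωp j <;> simp [hxj]
    · rw [Set.indicator_of_notMem hx, hf0 x hx]
  have hleft : ∀ᶠ ε : ℝ in 𝓝[>] 0, ∫ x, f x (ε⁻¹ • x) =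
      ∫ x in Ω, discExt aM eb Ωp xh x (ε⁻¹ • x) * φ x (ε⁻¹ • x) := by
    filter_upwards [self_mem_nhdsWithin] with ε hε
    rw [← integral_indicator hΩo.measurableSet]
    have hq : Measure.QuasiMeasurePreserving (fun x : Fin d → ℝ => ε⁻¹ • x) volume volume :=
      Measure.quasiMeasurePreserving_smul volume (inv_ne_zero (ne_of_gt hε))
    refine integral_congr_ae ?_
    filter_upwards [hq.ae hbae'] with x hx
    rw [← hfeq x _ hx]
    by_cases h : x ∈ Ω <;> simp [h]
  have hright : ∫ x, ∫ y, f x y ∂cubeMeasure d =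
      ∫ x in Ω, ∫ y in unitCube d, discExt aM eb Ωp xh x y * φ x y := by
    rw [← integral_indicator hΩo.measurableSet, ← cubeMeasure_eq_restrict_unitCube]
    refine integral_congr_ae (ae_of_all _ fun x => ?_)
    simp only
    by_cases hx : x ∈ Ω
    · rw [Set.indicator_of_mem hx]
      refine integral_congr_ae ?_
      filter_upwards [ae_restrict_of_ae hbae'] with y hy
      rw [← hfeq x y hy, Set.indicator_of_mem hx]
    · simp [Set.indicator_of_notMem hx, hf0 x hx]
  rw [← hright]
  refine Tendsto.congr' hleft (tendsto_integral_oscillating f ?_ ?_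
    (fun y => ∑ j, ‖b j y‖ * |C|) ?_ ?_ R ?_ ?_)
  · refine Finset.measurable_sum _ fun j _ => Measurable.mul ?_ (Measurable.mul ?_ hΦm)
    · exact (measurable_const.indicator (hmeas j)).comp measurable_fst
    · exact (hbm j).comp (measurable_fractVec.comp measurable_snd)
  · intro x y
    simp only [f, hΦp, fractVec_fractVec]
  · exact integrable_finsetSum _ fun j _ => ((hb j).congr (hbeq j)).norm.mul_const _
  · intro x y
    refine norm_sum_le_of_le _ fun j _ => ?_
    by_cases hx : x ∈ Ωp j
    · have hxK : x ∈ K := subset_closure (hsub j hx)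
      rw [Set.indicator_of_mem hx, one_mul, norm_mul, hΦ x hxK, ← hper.apply_fractVec x y]
      exact mul_le_mul_of_nonneg_left ((hC (x, fractVec y) ⟨hxK, hfQ y⟩).trans (le_abs_self C))
        (norm_nonneg _)
    · rw [Set.indicator_of_notMem hx, zero_mul, norm_zero]
      positivity
  · exact fun x y hx => hf0 x (fun h => absurd (hR x h) (not_le.2 hx)) y
  · have hfrae : ∀ᵐ x : Fin d → ℝ, ∀ j, x ∉ frontier (Ωp j) :=
      ae_all_iff.2 fun j => measure_eq_zero_iff_ae_notMem.1 (hfr j)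
    filter_upwards [hfrae] with x hx y
    refine tendsto_finsetSum _ fun j _ => ?_
    refine continuousAt_indicator_mul (hx j) fun hxi => ?_
    have hKx : K ∈ 𝓝 x := mem_of_superset (mem_interior_iff_mem_nhds.1 hxi)
      ((hsub j).trans subset_closure)
    have hφc : ContinuousAt (fun z => φ z (fractVec y)) x := by
      refine ContinuousOn.continuousAt ?_ hKx
      exact hcont.comp (f := fun z => (z, fractVec y)) (by fun_prop) fun z hz => ⟨hz, hfQ y⟩
    refine continuousAt_const.fun_mul (hφc.congr ?_)
    filter_upwards [hKx] with z hz
    rw [hΦ z hz, hper.apply_fractVec]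

end
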